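/- arXiv:2408.07447 — 9 statements merged into one kernel-verified Lean document; each statement's English description precedes it below -/
import Mathlib

section
/- Fix n ≥ 2 and let N = Σ_{i=1}^{n−1} x_{i+1} ∂/∂x_i, regarded as a derivation of ℝ[x_1,…,x_n]. Then for every 1 ≤ q ≤ n one has [N, 𝔱^q] ⊆ 𝔱^{min(q, n−1)}; in particular [N, 𝔱^q] ⊆ 𝔱^q whenever q ≤ n−1, and [N, 𝔱^n] ⊆ 𝔱^{n−1}. -/
open MvPolynomial

/-- The space `𝔱^p` of triangular (feed forward) polynomial vector fields on `ℝⁿ`: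
derivations `D` of `ℝ[x_1,…,x_n]` such that `D(x_i) ∈ ℝ[x_i,…,x_n]` for `i ≤ p`
(0-based: `i < p`) and `D(x_i) = 0` for `i > p` (0-based: `p ≤ i`). -/
def Tspace (n p : ℕ) :
    Set (Derivation ℝ (MvPolynomial (Fin n) ℝ) (MvPolynomial (Fin n) ℝ)) :=
  {D | ∀ i : Fin n,
    ((i : ℕ) < p → D (X i) ∈ MvPolynomial.supported ℝ {j : Fin n | i ≤ j}) ∧
    (p ≤ (i : ℕ) → D (X i) = 0)}

/-- The nilpotent vector field `N = Σ_{i=1}^{n-1} x_{i+1} ∂/∂x_i` as a derivation. -/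
noncomputable def Nvf (n : ℕ) :
    Derivation ℝ (MvPolynomial (Fin n) ℝ) (MvPolynomial (Fin n) ℝ) :=
  MvPolynomial.mkDerivation ℝ (fun i : Fin n =>
    if h : (i : ℕ) + 1 < n then X (⟨(i : ℕ) + 1, h⟩ : Fin n) else 0)

/-- A derivation sending each variable of `s` into `ℝ[X_s]` preserves `ℝ[X_s]`. -/
theorem derivation_mem_supported {σ R : Type*} [CommSemiring R] {s : Set σ}
    (D : Derivation R (MvPolynomial σ R) (MvPolynomial σ R))
    (hD : ∀ j ∈ s, D (X j) ∈ supported R s) {f : MvPolynomial σ R} (hf : f ∈ supported R s) :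
    D f ∈ supported R s := by
  induction hf using Algebra.adjoin_induction with
  | mem x hx =>
    obtain ⟨j, hj, rfl⟩ := hx
    exact hD j hj
  | algebraMap r => simp
  | add x y _ _ hx hy => simpa using add_mem hx hy
  | mul x y hxs hys hx hy =>
    rw [D.leibniz]
    exact add_mem (mul_mem hxs hy) (mul_mem hys hx)

theorem Nvf_X_of_lt {n : ℕ} {i : Fin n} (h : (i : ℕ) + 1 < n) :
    Nvf n (X i) = X ⟨(i : ℕ) + 1, h⟩ := by
  simp [Nvf, mkDerivation_X, h]

theorem Nvf_X_of_le {n : ℕ} {i : Fin n} (h : n ≤ (i : ℕ) + 1) : Nvf n (X i) = 0 := by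
  simp [Nvf, mkDerivation_X, h]

/-- `N` preserves `ℝ[x_i, …, x_n]`. -/
theorem Nvf_mem_supported {n : ℕ} (i : Fin n) {f : MvPolynomial (Fin n) ℝ}
    (hf : f ∈ supported ℝ {j : Fin n | i ≤ j}) :
    Nvf n f ∈ supported ℝ {j : Fin n | i ≤ j} := by
  refine derivation_mem_supported _ (fun j hj => ?_) hf
  by_cases h : (j : ℕ) + 1 < n
  · rw [Nvf_X_of_lt h, X_mem_supported]
    exact Fin.le_def.2 (Nat.le_succ_of_le (Fin.le_def.1 hj))
  · rw [Nvf_X_of_le (not_lt.1 h)]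
    exact zero_mem _

/-- `N` annihilates polynomials in the last variable. -/
theorem Nvf_eq_zero_of_mem_supported {n : ℕ} {i : Fin n} (hi : n ≤ (i : ℕ) + 1)
    {f : MvPolynomial (Fin n) ℝ} (hf : f ∈ supported ℝ {j : Fin n | i ≤ j}) :
    Nvf n f = 0 :=
  derivation_eqOn_supported (D₂ := 0) (fun _ hj =>
    Nvf_X_of_le (hi.trans (Nat.succ_le_succ (Fin.le_def.1 hj)))) hf

/-- Every component of a field in `𝔱^p` is triangular. -/
theorem apply_X_mem_supported_of_mem_Tspace {n p : ℕ}
    {D : Derivation ℝ (MvPolynomial (Fin n) ℝ) (MvPolynomial (Fin n) ℝ)}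
    (hD : D ∈ Tspace n p) (i : Fin n) : D (X i) ∈ supported ℝ {j : Fin n | i ≤ j} := by
  rcases lt_or_ge (i : ℕ) p with h | h
  · exact (hD i).1 h
  · rw [(hD i).2 h]
    exact zero_mem _

/-- `[N, 𝔱^q] ⊆ 𝔱^{min(q, n-1)}`. -/
theorem bracket_N_mem_Tspace (n : ℕ) (hn : 2 ≤ n) (q : ℕ) (hq1 : 1 ≤ q) (hqn : q ≤ n)
    (D : Derivation ℝ (MvPolynomial (Fin n) ℝ) (MvPolynomial (Fin n) ℝ))
    (hD : D ∈ Tspace n q) :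
    ⁅Nvf n, D⁆ ∈ Tspace n (min q (n - 1)) := by
  intro i
  rw [Derivation.commutator_apply]
  refine ⟨fun _ => sub_mem
    (Nvf_mem_supported i (apply_X_mem_supported_of_mem_Tspace hD i)) ?_, fun hi => ?_⟩
  · by_cases h : (i : ℕ) + 1 < n
    · rw [Nvf_X_of_lt h]
      exact supported_mono (fun j hj => Fin.le_def.2 (Nat.le_of_succ_le (Fin.le_def.1 hj)))
        (apply_X_mem_supported_of_mem_Tspace hD ⟨(i : ℕ) + 1, h⟩)
    · rw [Nvf_X_of_le (not_lt.1 h), map_zero]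
      exact zero_mem _
  · by_cases h : (i : ℕ) + 1 < n
    · have hqi : q ≤ (i : ℕ) := by omega
      rw [Nvf_X_of_lt h, (hD i).2 hqi, (hD ⟨(i : ℕ) + 1, h⟩).2 (Nat.le_succ_of_le hqi),
        map_zero, sub_zero]
    · rw [Nvf_eq_zero_of_mem_supported (not_lt.1 h) (apply_X_mem_supported_of_mem_Tspace hD i),
        Nvf_X_of_le (not_lt.1 h), map_zero, sub_zero]
end

section
/- Fix n ≥ 1 and 1 ≤ p ≤ n, and define the derivations of ℝ[x_1,…,x_n]: N_p = Σ_{i=p}^{n−1} x_{i+1} ∂/∂x_i, H_p = Σ_{i=p}^{n} (n+p−2i) x_i ∂/∂x_i, and M_p = Σ_{i=p+1}^{n} (i−p)(n−i+1) x_{i−1} ∂/∂x_i. Then these satisfy the sl₂ commutation relations [M_p, N_p] = H_p, [H_p, N_p] = −2 N_p, and [H_p, M_p] = 2 M_p. -/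
open MvPolynomial

/-- `N_p = Σ_{i=p}^{n-1} x_{i+1} ∂/∂x_i` (1-based indices) as a derivation of `ℝ[x_1,…,x_n]`. -/
noncomputable def Np (n p : ℕ) :
    Derivation ℝ (MvPolynomial (Fin n) ℝ) (MvPolynomial (Fin n) ℝ) :=
  MvPolynomial.mkDerivation ℝ (fun i : Fin n =>
    if h : p ≤ (i : ℕ) + 1 ∧ (i : ℕ) + 1 < n then X (⟨(i : ℕ) + 1, h.2⟩ : Fin n) else 0)

/-- `H_p = Σ_{i=p}^{n} (n+p-2i) x_i ∂/∂x_i` (1-based indices) as a derivation. -/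
noncomputable def Hp (n p : ℕ) :
    Derivation ℝ (MvPolynomial (Fin n) ℝ) (MvPolynomial (Fin n) ℝ) :=
  MvPolynomial.mkDerivation ℝ (fun i : Fin n =>
    if p ≤ (i : ℕ) + 1 then
      C (((n : ℝ) + (p : ℝ)) - 2 * ((i : ℕ) + 1 : ℝ)) * X i
    else 0)

/-- `M_p = Σ_{i=p+1}^{n} (i-p)(n-i+1) x_{i-1} ∂/∂x_i` (1-based indices) as a derivation. -/
noncomputable def Mp (n p : ℕ) :
    Derivation ℝ (MvPolynomial (Fin n) ℝ) (MvPolynomial (Fin n) ℝ) :=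
  MvPolynomial.mkDerivation ℝ (fun i : Fin n =>
    if p + 1 ≤ (i : ℕ) + 1 then
      C ((((i : ℕ) + 1 : ℝ) - (p : ℝ)) * ((n : ℝ) - ((i : ℕ) + 1 : ℝ) + 1)) *
        X (⟨(i : ℕ) - 1, Nat.lt_of_le_of_lt (Nat.sub_le _ _) i.isLt⟩ : Fin n)
    else 0)

theorem Np_X (n p : ℕ) (i : Fin n) : Np n p (X i) =
    if h : p ≤ (i : ℕ) + 1 ∧ (i : ℕ) + 1 < n then X (⟨(i : ℕ) + 1, h.2⟩ : Fin n) else 0 :=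
  mkDerivation_X _ _ _

theorem Hp_X (n p : ℕ) (i : Fin n) : Hp n p (X i) =
    if p ≤ (i : ℕ) + 1 then
      C (((n : ℝ) + (p : ℝ)) - 2 * ((i : ℕ) + 1 : ℝ)) * X i
    else 0 :=
  mkDerivation_X _ _ _

theorem Mp_X (n p : ℕ) (i : Fin n) : Mp n p (X i) =
    if p + 1 ≤ (i : ℕ) + 1 then
      C ((((i : ℕ) + 1 : ℝ) - (p : ℝ)) * ((n : ℝ) - ((i : ℕ) + 1 : ℝ) + 1)) *
        X (⟨(i : ℕ) - 1, Nat.lt_of_le_of_lt (Nat.sub_le _ _) i.isLt⟩ : Fin n)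
    else 0 :=
  mkDerivation_X _ _ _

theorem derivation_apply_C_mul {σ R : Type*} [CommRing R]
    (D : Derivation R (MvPolynomial σ R) (MvPolynomial σ R)) (a : R) (f : MvPolynomial σ R) :
    D (C a * f) = C a * D f := by
  rw [C_mul', D.map_smul, C_mul']

theorem lie_Mp_Np (n p : ℕ) (hp : 1 ≤ p) : ⁅Mp n p, Np n p⁆ = Hp n p := by
  refine MvPolynomial.derivation_ext fun i => ?_
  obtain ⟨i, hi⟩ := i
  rw [Derivation.commutator_apply, Np_X, Mp_X, Hp_X]
  by_cases h : p ≤ i + 1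
  · have hMN : Mp n p (if h : p ≤ i + 1 ∧ i + 1 < n then X (⟨i + 1, h.2⟩ : Fin n) else 0) =
        C (((i : ℝ) + 2 - p) * (n - (i + 1))) * X (⟨i, hi⟩ : Fin n) := by
      split_ifs with h1
      · rw [Mp_X, if_pos (by simpa using h)]
        simp only [Nat.add_sub_cancel]
        push_cast
        ring_nf
      · have : (n : ℝ) = i + 1 := by
          exact_mod_cast (by omega : n = i + 1)
        simp [this]
    have hNM : Np n p (if p + 1 ≤ i + 1 then
        C ((((i : ℕ) + 1 : ℝ) - (p : ℝ)) * ((n : ℝ) - ((i : ℕ) + 1 : ℝ) + 1)) *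
          X (⟨i - 1, Nat.lt_of_le_of_lt (Nat.sub_le _ _) hi⟩ : Fin n) else 0) =
        C (((i : ℝ) + 1 - p) * (n - i)) * X (⟨i, hi⟩ : Fin n) := by
      split_ifs with h1
      · have hi1 : i - 1 + 1 = i := by omega
        rw [derivation_apply_C_mul, Np_X, dif_pos (by dsimp only; omega)]
        simp only [hi1]
        ring_nf
      · have : (p : ℝ) = i + 1 := by
          exact_mod_cast (by omega : p = i + 1)
        simp [this]
    simp only [hMN, hNM, if_pos h, ← sub_mul, ← C_sub]
    ring_nf
  · have h1 : ¬ p + 1 ≤ i + 1 := by omega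
    simp [h, h1]

theorem lie_Hp_Np (n p : ℕ) : ⁅Hp n p, Np n p⁆ = (-2 : ℝ) • Np n p := by
  refine MvPolynomial.derivation_ext fun i => ?_
  obtain ⟨i, hi⟩ := i
  rw [Derivation.commutator_apply, Derivation.smul_apply, Hp_X, Np_X]
  by_cases h : p ≤ i + 1
  · rw [if_pos h, derivation_apply_C_mul, Np_X]
    by_cases h1 : i + 1 < n
    · simp only [h, h1, and_self, dite_true]
      rw [Hp_X, if_pos (by dsimp only; omega), ← C_mul', ← sub_mul, ← C_sub]
      push_cast
      ring_nf
    · simp [h1]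
  · simp [h]

theorem lie_Hp_Mp (n p : ℕ) (hp : 1 ≤ p) : ⁅Hp n p, Mp n p⁆ = (2 : ℝ) • Mp n p := by
  refine MvPolynomial.derivation_ext fun i => ?_
  obtain ⟨i, hi⟩ := i
  rw [Derivation.commutator_apply, Derivation.smul_apply, Hp_X, Mp_X]
  by_cases h : p + 1 ≤ i + 1
  · have hi1 : ((i - 1 : ℕ) : ℝ) = i - 1 := by
      rw [Nat.cast_sub (by omega), Nat.cast_one]
    rw [if_pos h, if_pos (by dsimp only; omega), derivation_apply_C_mul, derivation_apply_C_mul, Mp_X,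
      if_pos h, Hp_X, if_pos (by dsimp only; omega), ← C_mul']
    simp only [hi1, ← mul_assoc, ← C_mul, ← sub_mul, ← C_sub]
    ring_nf
  · rw [if_neg h]
    split_ifs
    · rw [derivation_apply_C_mul, Mp_X, if_neg h]
      simp
    · simp

/-- `⟨N_p, H_p, M_p⟩` is an sl₂-triple:
`[M_p, N_p] = H_p`, `[H_p, N_p] = -2 N_p`, `[H_p, M_p] = 2 M_p`. -/
theorem triangular_sl2_triple (n p : ℕ) (hn : 1 ≤ n) (hp : 1 ≤ p) (hpn : p ≤ n) :
    ⁅Mp n p, Np n p⁆ = Hp n p ∧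
    ⁅Hp n p, Np n p⁆ = (-2 : ℝ) • Np n p ∧
    ⁅Hp n p, Mp n p⁆ = (2 : ℝ) • Mp n p := by
  exact ⟨lie_Mp_Np n p hp, lie_Hp_Np n p, lie_Hp_Mp n p hp⟩
end

section
/- Fix n ≥ 1 and 1 ≤ p ≤ n, and consider the ℝ-linear operators on the polynomial ring ℝ[x_p,…,x_n] given by L_{N_p}(f) = Σ_{i=p}^{n−1} x_{i+1} ∂f/∂x_i and L_{M_p}(f) = Σ_{i=p+1}^{n} (i−p)(n−i+1) x_{i−1} ∂f/∂x_i. Then the range of L_{N_p} and the kernel of L_{M_p} are complementary ℝ-subspaces of ℝ[x_p,…,x_n]: their intersection is {0} and their sum is all of ℝ[x_p,…,x_n]. -/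
open MvPolynomial

/-- The subspace `ℝ[x_p,…,x_n]` of `ℝ[x_1,…,x_n]` (1-based indices). -/
noncomputable def Rp (n p : ℕ) : Submodule ℝ (MvPolynomial (Fin n) ℝ) :=
  Subalgebra.toSubmodule (MvPolynomial.supported ℝ {j : Fin n | p ≤ (j : ℕ) + 1})

namespace LinearMap

variable {K V : Type*} [Field K] [AddCommGroup V] [Module K V]

/-- If `N` and `M` are adjoint to each other for an anisotropic bilinear form, then the range of
`N` meets the kernel of `M` trivially. -/
theorem disjoint_range_ker_of_adjoint {B : V →ₗ[K] V →ₗ[K] K} (hB : ∀ v, B v v = 0 → v = 0)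
    {N M : V →ₗ[K] V} (h : ∀ v w, B (N v) w = B v (M w)) :
    Disjoint (range N) (ker M) := by
  rw [Submodule.disjoint_def]
  rintro _ ⟨v, rfl⟩ hv
  apply hB
  rw [h, mem_ker.1 hv, map_zero]

/-- In finite dimension, the range of `N` and the kernel of its adjoint `M` span the space. -/
theorem range_sup_ker_of_adjoint [FiniteDimensional K V] {B : V →ₗ[K] V →ₗ[K] K}
    (hB : ∀ v, B v v = 0 → v = 0) {N M : V →ₗ[K] V} (h : ∀ v w, B (N v) w = B v (M w))
    (h' : ∀ v w, B (M v) w = B v (N w)) :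
    range N ⊔ ker M = ⊤ := by
  have hNM := disjoint_range_ker_of_adjoint hB h
  have hMN := Submodule.finrank_add_finrank_le_of_disjoint (disjoint_range_ker_of_adjoint hB h')
  have hN := finrank_range_add_finrank_ker N
  have hM := finrank_range_add_finrank_ker M
  exact Submodule.eq_top_of_disjoint _ _ (by omega) hNM

end LinearMap

namespace MvPolynomial

variable {σ K : Type*} [Field K]

theorem derivation_eq_sum_pderiv [Fintype σ]
    (D : Derivation K (MvPolynomial σ K) (MvPolynomial σ K)) (f : MvPolynomial σ K) :
    D f = ∑ i, D (X i) * pderiv i f := by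
  classical
  have hsum : ∀ g, (∑ i, D (X i) • pderiv i : Derivation K _ _) g = ∑ i, D (X i) * pderiv i g :=
    fun g => by
      rw [← Derivation.coeFnAddMonoidHom_apply, map_sum, Finset.sum_apply]
      rfl
  have h : D = ∑ i, D (X i) • pderiv i :=
    derivation_ext fun j => by
      simp [hsum, pderiv_X, Pi.single_apply]
  rw [← hsum, ← h]

theorem totalDegree_derivation_le [Fintype σ]
    {D : Derivation K (MvPolynomial σ K) (MvPolynomial σ K)}
    (hD : ∀ i, (D (X i)).IsHomogeneous 1) (f : MvPolynomial σ K) :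
    (D f).totalDegree ≤ f.totalDegree := by
  have key : ∀ (k : ℕ) (g : MvPolynomial σ K), g.IsHomogeneous k → (D g).totalDegree ≤ k := by
    intro k g hg
    rcases k with _ | k
    · rw [← totalDegree_zero_iff_isHomogeneous] at hg
      rw [totalDegree_eq_zero_iff_eq_C.1 hg, derivation_C, totalDegree_zero]
    · rw [derivation_eq_sum_pderiv]
      refine IsHomogeneous.totalDegree_le (.sum _ _ _ fun i _ => ?_)
      have := (hD i).mul (hg.pderiv (i := i))
      rwa [Nat.add_sub_cancel, add_comm] at this
  conv_lhs => rw [← sum_homogeneousComponent f, map_sum]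
  refine totalDegree_finsetSum_le fun k hk => (key k _ (homogeneousComponent_isHomogeneous k f)).trans ?_
  exact Nat.le_of_lt_succ (Finset.mem_range.1 hk)

theorem derivation_mem_supported {D : Derivation K (MvPolynomial σ K) (MvPolynomial σ K)}
    {s : Set σ} (hD : ∀ i ∈ s, D (X i) ∈ supported K s) {f : MvPolynomial σ K}
    (hf : f ∈ supported K s) : D f ∈ supported K s := by
  induction hf using Algebra.adjoin_induction with
  | mem x hx =>
    obtain ⟨i, hi, rfl⟩ := hx
    exact hD i hi
  | algebraMap r => simp
  | add f g _ _ hf hg =>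
    rw [map_add]
    exact add_mem hf hg
  | mul f g hf' hg' hf hg =>
    rw [Derivation.leibniz]
    exact add_mem (mul_mem hf' hg) (mul_mem hg' hf)

/-- The squared norm of the monomial with exponent `a` for the weighted Fischer form. -/
def fischerWeight [Fintype σ] (w : σ → K) (a : σ →₀ ℕ) : K :=
  ∏ i, ((a i).factorial : K) * w i ^ a i

theorem fischerWeight_add_single [Fintype σ] (w : σ → K) (a : σ →₀ ℕ) (i : σ) :
    fischerWeight w (a + Finsupp.single i 1) = w i * (a i + 1) * fischerWeight w a := by
  classical
  unfold fischerWeight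
  rw [← Finset.mul_prod_erase _ _ (Finset.mem_univ i),
    ← Finset.mul_prod_erase _ (fun j => ((a j).factorial : K) * w j ^ a j) (Finset.mem_univ i)]
  rw [Finset.prod_congr rfl fun j hj => by
    rw [Finsupp.add_apply, Finsupp.single_eq_of_ne (Finset.ne_of_mem_erase hj), add_zero]]
  simp only [Finsupp.add_apply, Finsupp.single_eq_same, Nat.factorial_succ, pow_succ]
  push_cast
  ring

/-- The weighted Fischer form: monomials are orthogonal, with squared norms `fischerWeight w`. -/
noncomputable def fischerForm [Fintype σ] (w : σ → K) :
    MvPolynomial σ K →ₗ[K] MvPolynomial σ K →ₗ[K] K :=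
  (basisMonomials σ K).constr K fun a => fischerWeight w a • lcoeff K a

theorem fischerForm_monomial [Fintype σ] (w : σ → K) (a : σ →₀ ℕ) (g : MvPolynomial σ K) :
    fischerForm w (monomial a 1) g = fischerWeight w a * coeff a g := by
  have h := (basisMonomials σ K).constr_basis K (fun a => fischerWeight w a • lcoeff K a) a
  rw [coe_basisMonomials] at h
  rw [fischerForm, h]
  rfl

theorem fischerForm_X_mul [Fintype σ] (w : σ → K) (i : σ) (f g : MvPolynomial σ K) :
    fischerForm w (X i * f) g = w i * fischerForm w f (pderiv i g) := by
  have h : (fischerForm w).comp (LinearMap.mulLeft K (X i)) =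
      w i • (fischerForm w).compl₂ (pderiv i).toLinearMap := by
    refine (basisMonomials σ K).ext fun a => LinearMap.ext fun g => ?_
    have hX : X i * monomial a (1 : K) = monomial (a + Finsupp.single i 1) 1 := by
      rw [X, monomial_mul, add_comm, one_mul]
    simp only [coe_basisMonomials, LinearMap.comp_apply, LinearMap.mulLeft_apply, hX,
      fischerForm_monomial, LinearMap.smul_apply, LinearMap.compl₂_apply, Derivation.coeFn_coe,
      coeff_pderiv, fischerWeight_add_single, smul_eq_mul]
    ring
  exact LinearMap.congr_fun₂ h f g

theorem eq_zero_of_fischerForm_self_eq_zero [Fintype σ] [LinearOrder K] [IsStrictOrderedRing K]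
    {w : σ → K} (hw : ∀ i, 0 < w i) (f : MvPolynomial σ K) (hf : fischerForm w f f = 0) :
    f = 0 := by
  have hpos : ∀ a, 0 < fischerWeight w a := fun a =>
    Finset.prod_pos fun i _ => mul_pos (by positivity) (pow_pos (hw i) _)
  have hsum : fischerForm w f f = ∑ a ∈ f.support, fischerWeight w a * coeff a f ^ 2 := by
    conv_lhs => enter [1]; rw [f.as_sum, map_sum]
    rw [LinearMap.sum_apply]
    refine Finset.sum_congr rfl fun a _ => ?_
    rw [← mul_one (coeff a f), ← smul_eq_mul, ← smul_monomial, map_smul, LinearMap.smul_apply,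
      fischerForm_monomial, smul_eq_mul, smul_eq_mul]
    ring
  rw [hsum, Finset.sum_eq_zero_iff_of_nonneg fun a _ =>
    mul_nonneg (hpos a).le (sq_nonneg _)] at hf
  ext a
  by_contra ha
  have := hf a (mem_support_iff.2 ha)
  exact mul_ne_zero (hpos a).ne' (pow_ne_zero 2 ha) this

theorem fischerForm_comm [Fintype σ] (w : σ → K) (f g : MvPolynomial σ K) :
    fischerForm w f g = fischerForm w g f := by
  classical
  have h : fischerForm w = (fischerForm w).flip := by
    refine (basisMonomials σ K).ext fun a => (basisMonomials σ K).ext fun b => ?_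
    simp only [coe_basisMonomials, LinearMap.flip_apply, fischerForm_monomial, coeff_monomial]
    by_cases hab : a = b
    · subst hab; rfl
    · simp [hab, Ne.symm hab]
  exact LinearMap.congr_fun₂ h f g

/-- Linear vector fields whose matrices are transposes of each other up to the weights are adjoint
for the weighted Fischer form. -/
theorem fischerForm_derivation_adjoint [Fintype σ] {w : σ → K} {A A' : σ → σ → K}
    {D D' : Derivation K (MvPolynomial σ K) (MvPolynomial σ K)}
    (hD : ∀ i, D (X i) = ∑ j, A i j • X j) (hD' : ∀ i, D' (X i) = ∑ j, A' i j • X j)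
    (hA : ∀ i j, A i j * w j = A' j i * w i) (f g : MvPolynomial σ K) :
    fischerForm w (D f) g = fischerForm w f (D' g) := by
  rw [fischerForm_comm w f, derivation_eq_sum_pderiv D, derivation_eq_sum_pderiv D']
  simp only [hD, hD', Finset.sum_mul, map_sum, LinearMap.sum_apply, smul_mul_assoc, map_smul,
    LinearMap.smul_apply, fischerForm_X_mul, smul_eq_mul, ← mul_assoc]
  rw [Finset.sum_comm]
  refine Finset.sum_congr rfl fun i _ => Finset.sum_congr rfl fun j _ => ?_
  rw [hA, fischerForm_comm]

end MvPolynomial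

/-- The factor `(j - p) (n - j + 1)` of `x_{j-1} ∂/∂x_j` in `M_p`, as a function of the 0-based
index of `x_{j-1}`. -/
noncomputable def raisingCoeff (n p k : ℕ) : ℝ :=
  if p ≤ k + 1 ∧ k + 1 < n then ((k : ℝ) + 2 - p) * ((n : ℝ) - k - 1) else 1

theorem raisingCoeff_pos (n p k : ℕ) : 0 < raisingCoeff n p k := by
  unfold raisingCoeff
  split_ifs with h
  · have h₁ : (p : ℝ) ≤ k + 1 := by exact_mod_cast h.1
    have h₂ : (k : ℝ) + 1 < n := by exact_mod_cast h.2
    exact mul_pos (by linarith) (by linarith)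
  · exact one_pos

/-- The weights making `N_p` and `M_p` adjoint for the Fischer form. -/
noncomputable def slWeight (n p : ℕ) (i : Fin n) : ℝ :=
  ∏ k ∈ Finset.range i, raisingCoeff n p k

theorem slWeight_pos (n p : ℕ) (i : Fin n) : 0 < slWeight n p i :=
  Finset.prod_pos fun _ _ => raisingCoeff_pos n p _

/-- The matrix of `N_p` on the variables. -/
noncomputable def NpMatrix (n p : ℕ) (i j : Fin n) : ℝ :=
  if p ≤ (i : ℕ) + 1 ∧ (j : ℕ) = i + 1 then 1 else 0

/-- The matrix of `M_p` on the variables. -/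
noncomputable def MpMatrix (n p : ℕ) (i j : Fin n) : ℝ :=
  if p ≤ (j : ℕ) + 1 ∧ (i : ℕ) = j + 1 then raisingCoeff n p j else 0

theorem NpMatrix_mul_slWeight (n p : ℕ) (i j : Fin n) :
    NpMatrix n p i j * slWeight n p j = MpMatrix n p j i * slWeight n p i := by
  unfold NpMatrix MpMatrix
  split_ifs with h
  · rw [slWeight, slWeight, h.2, Finset.prod_range_succ, one_mul, mul_comm]
  · simp

theorem Np_X_s5 (n p : ℕ) (i : Fin n) : Np n p (X i) = ∑ j, NpMatrix n p i j • X j := by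
  rw [Np, mkDerivation_X]
  unfold NpMatrix
  split_ifs with h
  · rw [Finset.sum_eq_single ⟨(i : ℕ) + 1, h.2⟩]
    · simp [h.1]
    · intro j _ hj
      rw [if_neg fun h' => hj (Fin.ext h'.2), zero_smul]
    · simp
  · refine (Finset.sum_eq_zero fun j _ => ?_).symm
    rw [if_neg, zero_smul]
    have := j.isLt
    omega

theorem Mp_X_s5 {n p : ℕ} (hp : 1 ≤ p) (i : Fin n) :
    Mp n p (X i) = ∑ j, MpMatrix n p i j • X j := by
  rw [Mp, mkDerivation_X]
  unfold MpMatrix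
  have hi := i.isLt
  split_ifs with h
  · obtain ⟨k, hk⟩ : ∃ k, (i : ℕ) = k + 1 := ⟨i - 1, by omega⟩
    rw [Finset.sum_eq_single ⟨(i : ℕ) - 1, by omega⟩]
    · rw [if_pos ⟨by simp only; omega, by simp only; omega⟩, C_mul']
      congr 1
      simp only [hk, Nat.add_sub_cancel, raisingCoeff]
      rw [if_pos ⟨by omega, by omega⟩]
      push_cast
      ring
    · intro j _ hj
      rw [if_neg fun h' => hj (Fin.ext (by simp only; omega)), zero_smul]
    · simp
  · refine (Finset.sum_eq_zero fun j _ => ?_).symm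
    rw [if_neg (by omega), zero_smul]

theorem isHomogeneous_sum_smul_X {n : ℕ} (a : Fin n → ℝ) :
    (∑ j, a j • X j : MvPolynomial (Fin n) ℝ).IsHomogeneous 1 :=
  .sum _ _ _ fun j _ => by
    simpa [smul_eq_C_mul] using (isHomogeneous_C (Fin n) (a j)).mul (isHomogeneous_X ℝ j)

theorem Np_mem_Rp {n p : ℕ} {f : MvPolynomial (Fin n) ℝ} (hf : f ∈ Rp n p) :
    Np n p f ∈ Rp n p := by
  refine derivation_mem_supported (fun i hi => ?_) hf
  rw [Np_X_s5]
  refine sum_mem fun j _ => ?_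
  unfold NpMatrix
  split_ifs with h
  · refine Subalgebra.smul_mem _ (X_mem_supported.2 ?_) _
    simp only [Set.mem_ofPred_eq]
    omega
  · simp

theorem Mp_mem_Rp {n p : ℕ} (hp : 1 ≤ p) {f : MvPolynomial (Fin n) ℝ} (hf : f ∈ Rp n p) :
    Mp n p f ∈ Rp n p := by
  refine derivation_mem_supported (fun i hi => ?_) hf
  rw [Mp_X_s5 hp]
  refine sum_mem fun j _ => ?_
  unfold MpMatrix
  split_ifs with h
  · refine Subalgebra.smul_mem _ (X_mem_supported.2 ?_) _
    exact h.1
  · simp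

/-- the range of `L_{N_p}` (on `ℝ[x_p,…,x_n]`) and the kernel of `L_{M_p}`
(in `ℝ[x_p,…,x_n]`) are complementary subspaces of `ℝ[x_p,…,x_n]`:
their intersection is `{0}` and their sum is all of `ℝ[x_p,…,x_n]`. -/
theorem range_LN_ker_LM_complementary (n p : ℕ) (hn : 1 ≤ n) (hp : 1 ≤ p) (hpn : p ≤ n) :
    (Submodule.map (Np n p).toLinearMap (Rp n p)) ⊓
        (Rp n p ⊓ LinearMap.ker (Mp n p).toLinearMap) = ⊥ ∧
    (Submodule.map (Np n p).toLinearMap (Rp n p)) ⊔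
        (Rp n p ⊓ LinearMap.ker (Mp n p).toLinearMap) = Rp n p := by
  have hB := eq_zero_of_fischerForm_self_eq_zero (slWeight_pos n p)
  have hNM := fischerForm_derivation_adjoint (Np_X_s5 n p) (Mp_X_s5 hp) (NpMatrix_mul_slWeight n p)
  have hMN := fischerForm_derivation_adjoint (Mp_X_s5 hp) (Np_X_s5 n p)
    fun i j => (NpMatrix_mul_slWeight n p j i).symm
  refine ⟨?_, le_antisymm (sup_le ?_ inf_le_left) fun f hf => ?_⟩
  · exact disjoint_iff.1 ((LinearMap.disjoint_range_ker_of_adjoint hB hNM).mono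
      LinearMap.map_le_range inf_le_right)
  · rintro _ ⟨f, hf, rfl⟩
    exact Np_mem_Rp hf
  · let W := Rp n p ⊓ restrictTotalDegree (Fin n) ℝ f.totalDegree
    have hNW : ∀ g ∈ W, (Np n p).toLinearMap g ∈ W := fun g hg =>
      ⟨Np_mem_Rp hg.1, (mem_restrictTotalDegree _ _ _).2 <|
        (totalDegree_derivation_le (fun i => Np_X_s5 n p i ▸ isHomogeneous_sum_smul_X _) g).trans <|
          (mem_restrictTotalDegree _ _ _).1 hg.2⟩
    have hMW : ∀ g ∈ W, (Mp n p).toLinearMap g ∈ W := fun g hg =>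
      ⟨Mp_mem_Rp hp hg.1, (mem_restrictTotalDegree _ _ _).2 <|
        (totalDegree_derivation_le (fun i => Mp_X_s5 hp i ▸ isHomogeneous_sum_smul_X _) g).trans <|
          (mem_restrictTotalDegree _ _ _).1 hg.2⟩
    have : FiniteDimensional ℝ W := Submodule.finiteDimensional_of_le inf_le_right
    have htop := LinearMap.range_sup_ker_of_adjoint
      (B := (fischerForm (slWeight n p)).domRestrict₁₂ W W)
      (N := (Np n p).toLinearMap.restrict hNW) (M := (Mp n p).toLinearMap.restrict hMW)
      (fun v hv => Subtype.ext (hB v hv)) (fun v w => hNM v w) (fun v w => hMN v w)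
    have hfW : (⟨f, hf, (mem_restrictTotalDegree _ _ _).2 le_rfl⟩ : W) ∈ (⊤ : Submodule ℝ W) :=
      Submodule.mem_top
    rw [← htop, Submodule.mem_sup] at hfW
    obtain ⟨_, ⟨g, rfl⟩, k, hk, hgk⟩ := hfW
    exact Submodule.mem_sup.2 ⟨_, ⟨g, g.2.1, rfl⟩, k, ⟨k.2.1, congrArg Subtype.val hk⟩,
      congrArg Subtype.val hgk⟩
end

section
/- Fix n ≥ 1, 1 ≤ p ≤ n, and l ≥ 0 with 2l ≤ n−p. Then the quadratic polynomial τ_p^{2l} satisfies L_{M_p}(τ_p^{2l}) = 0, i.e., τ_p^{2l} lies in the kernel of L_{M_p}, and moreover τ_p^{2l} is an eigenvector of L_{H_p} with eigenvalue 2(n−p)−4l, where L_{H_p}(f) = Σ_{i=p}^{n} (n+p−2i) x_i ∂f/∂x_i. -/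
open MvPolynomial

/-- The transvectant polynomial
`τ_p^k = Σ_{j=0}^{k} (-1)^{k-j} C(n-p-(k-j), j) C(n-p-j, k-j) x_{p+k-j} x_{p+j}`
(1-based variable indices). -/
noncomputable def tau (n p k : ℕ) (hp : 1 ≤ p) (hk : p + k ≤ n) :
    MvPolynomial (Fin n) ℝ :=
  ∑ j : Fin (k + 1),
    C ((-1 : ℝ) ^ (k - (j : ℕ)) *
        ((Nat.choose (n - p - (k - (j : ℕ))) (j : ℕ) : ℝ)) *
        ((Nat.choose (n - p - (j : ℕ)) (k - (j : ℕ)) : ℝ))) *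
      (X (⟨p + (k - (j : ℕ)) - 1, by have hj := j.isLt; omega⟩ : Fin n) *
       X (⟨p + (j : ℕ) - 1, by have hj := j.isLt; omega⟩ : Fin n))

/-- The variable `x_{p+a}` (1-based), extended by zero when the index exceeds `n`. -/
noncomputable def shiftedVar (n p a : ℕ) : MvPolynomial (Fin n) ℝ :=
  if h : p + a - 1 < n then X ⟨p + a - 1, h⟩ else 0

/-- The coefficient of `x_{p+a} x_{p+b}` in the transvectant, with `m = n - p`. -/
noncomputable def tauCoeff (m a b : ℕ) : ℝ :=
  (-1) ^ a * (Nat.choose (m - a) b : ℝ) * (Nat.choose (m - b) a : ℝ)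

theorem tau_eq_sum_range (n p k : ℕ) (hp : 1 ≤ p) (hk : p + k ≤ n) :
    tau n p k hp hk = ∑ j ∈ Finset.range (k + 1),
      C (tauCoeff (n - p) (k - j) j) * (shiftedVar n p (k - j) * shiftedVar n p j) := by
  rw [tau, Finset.sum_range]
  refine Finset.sum_congr rfl fun j _ => ?_
  have hj := j.isLt
  have h₁ : p + (k - (j : ℕ)) - 1 < n := by omega
  have h₂ : p + (j : ℕ) - 1 < n := by omega
  rw [shiftedVar, shiftedVar, dif_pos h₁, dif_pos h₂, tauCoeff]

theorem Mp_shiftedVar_zero (n p : ℕ) (hp : 1 ≤ p) : Mp n p (shiftedVar n p 0) = 0 := by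
  unfold shiftedVar
  split_ifs with h
  · rw [Mp, mkDerivation_X, if_neg]
    simp only
    omega
  · exact map_zero _

theorem Mp_shiftedVar_succ (n p a : ℕ) (hp : 1 ≤ p) (ha : p + a < n + 1) :
    Mp n p (shiftedVar n p (a + 1)) =
      C (((a : ℝ) + 1) * ((n : ℝ) - p - a)) * shiftedVar n p a := by
  obtain ⟨q, rfl⟩ : ∃ q, p = q + 1 := ⟨p - 1, by omega⟩
  unfold shiftedVar
  rw [dif_pos (show q + 1 + a - 1 < n by omega)]
  split_ifs with h
  · rw [Mp, mkDerivation_X, if_pos (by simp only; omega)]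
    have hidx : q + 1 + (a + 1) - 1 = q + a + 1 := by omega
    congr 2
    simp only [hidx]
    push_cast
    ring
  · have hn : n = q + 1 + a := by omega
    subst hn
    simp

theorem Hp_shiftedVar (n p a : ℕ) (hp : 1 ≤ p) :
    Hp n p (shiftedVar n p a) = C ((n : ℝ) - p - 2 * a) * shiftedVar n p a := by
  obtain ⟨q, rfl⟩ : ∃ q, p = q + 1 := ⟨p - 1, by omega⟩
  unfold shiftedVar
  split_ifs with h
  · rw [Hp, mkDerivation_X, if_pos (by simp only; omega)]
    have hidx : q + 1 + a - 1 = q + a := by omega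
    congr 2
    simp only [hidx]
    push_cast
    ring
  · simp

/-- The recurrence between neighbouring coefficients that makes the images cancel. -/
theorem tauCoeff_recurrence (m a b : ℕ) (h : a + b + 1 ≤ m) :
    tauCoeff m (a + 1) b * ((a + 1) * (m - a)) +
      tauCoeff m a (b + 1) * ((b + 1) * (m - b)) = 0 := by
  have key : ∀ c d : ℕ, c + 1 ≤ m →
      ((m : ℝ) - c) * (Nat.choose (m - (c + 1)) d : ℝ) =
        (Nat.choose (m - c) (d + 1) : ℝ) * (d + 1) := by
    intro c d hc
    obtain ⟨e, rfl⟩ := Nat.exists_eq_add_of_le hc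
    have h₁ : c + 1 + e - (c + 1) = e := by omega
    have h₂ : c + 1 + e - c = e + 1 := by omega
    rw [h₁, h₂]
    have := congrArg (Nat.cast (R := ℝ)) (Nat.add_one_mul_choose_eq e d)
    push_cast at this ⊢
    linear_combination this
  have ha := key a b (by omega)
  have hb := key b a (by omega)
  unfold tauCoeff
  rw [pow_succ]
  linear_combination
    (-(-1 : ℝ) ^ a * (Nat.choose (m - b) (a + 1) : ℝ) * (a + 1)) * ha +
      ((-1 : ℝ) ^ a * (Nat.choose (m - a) (b + 1) : ℝ) * (b + 1)) * hb

theorem Mp_tau (n p k : ℕ) (hp : 1 ≤ p) (hk : p + k ≤ n) :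
    Mp n p (tau n p k hp hk) = 0 := by
  rw [tau_eq_sum_range, map_sum]
  simp only [Derivation.leibniz, derivation_C, mul_zero, add_zero, mul_add, smul_eq_mul,
    Finset.sum_add_distrib]
  rw [Finset.sum_range_succ', Finset.sum_range_succ]
  simp only [Nat.sub_self, Nat.sub_zero, Mp_shiftedVar_zero n p hp, mul_zero, add_zero]
  rw [← Finset.sum_add_distrib]
  refine Finset.sum_eq_zero fun j hj => ?_
  obtain ⟨a, rfl⟩ := Nat.exists_eq_add_of_lt (Finset.mem_range.mp hj)
  have h₁ : j + a + 1 - (j + 1) = a := by omega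
  have h₂ : j + a + 1 - j = a + 1 := by omega
  rw [h₁, h₂, Mp_shiftedVar_succ n p j hp (by omega), Mp_shiftedVar_succ n p a hp (by omega)]
  have hrec := congrArg (C (σ := Fin n)) (tauCoeff_recurrence (n - p) a j (by omega))
  rw [Nat.cast_sub (show p ≤ n by omega)] at hrec
  simp only [map_add, map_mul, map_zero] at hrec ⊢
  linear_combination (shiftedVar n p a * shiftedVar n p j) * hrec

theorem Hp_tau (n p k : ℕ) (hp : 1 ≤ p) (hk : p + k ≤ n) :
    Hp n p (tau n p k hp hk) =
      (2 * ((n : ℝ) - (p : ℝ)) - 2 * (k : ℝ)) • tau n p k hp hk := by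
  rw [tau_eq_sum_range, map_sum, Finset.smul_sum]
  refine Finset.sum_congr rfl fun j hj => ?_
  obtain ⟨a, rfl⟩ := Nat.exists_eq_add_of_le (Nat.lt_succ_iff.mp (Finset.mem_range.mp hj))
  have h : j + a - j = a := by omega
  simp only [h, Derivation.leibniz, derivation_C, mul_zero, add_zero, smul_eq_mul,
    Hp_shiftedVar n p _ hp, smul_eq_C_mul]
  push_cast
  simp only [map_add, map_sub, map_mul, map_ofNat]
  ring

/-- `τ_p^{2l}` lies in the kernel of `L_{M_p}` and is an eigenvector of
`L_{H_p}` with eigenvalue `2(n-p) - 4l`. -/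
theorem tau_in_ker_Mp_and_eigenvector (n p l : ℕ) (hn : 1 ≤ n) (hp : 1 ≤ p) (hpn : p ≤ n)
    (h2l : 2 * l ≤ n - p) :
    Mp n p (tau n p (2 * l) hp (by omega)) = 0 ∧
    Hp n p (tau n p (2 * l) hp (by omega)) =
      (2 * ((n : ℝ) - (p : ℝ)) - 4 * (l : ℝ)) • tau n p (2 * l) hp (by omega) := by
  refine ⟨Mp_tau n p (2 * l) hp _, ?_⟩
  rw [Hp_tau]
  congr 1
  push_cast
  ring
end

section
/- Fix n ≥ 1, l ≥ 1 and 1 ≤ p with p + 2l ≤ n. There exist real numbers α, β₁, …, β_l such that in ℝ[x_1,…,x_n] the following identity holds: α·x_{p+1}·x_{p+2l−1} − Σ_{j=1}^{l} β_j·(x_{p+2l−j+1}·x_{p+j−1} + x_{p+2l−j}·x_{p+j}) = τ_p^{2l}. -/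
open MvPolynomial

/-- In a module, every combination of `f 0, …, f l` is a combination of `f 1` and the sums
`f j + f (j + 1)` of neighbours. -/
theorem exists_smul_sub_sum_smul_add_succ {R M : Type*} [CommRing R] [AddCommGroup M] [Module R M]
    (f : ℕ → M) (d : ℕ → R) (l : ℕ) (hl : 1 ≤ l) (c : R) :
    ∃ (α : R) (β : ℕ → R),
      α • f 1 - ∑ j ∈ Finset.range l, β j • (f j + f (j + 1)) =
        ∑ j ∈ Finset.range l, d j • f j + c • f l := by
  induction l, hl using Nat.le_induction generalizing c with
  | base =>
    refine ⟨c - d 0, fun _ => -d 0, ?_⟩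
    simp only [Finset.sum_range_one, zero_add]
    module
  | succ l hl ih =>
    obtain ⟨α, β, h⟩ := ih (d l - c)
    refine ⟨α, fun j => if j = l then -c else β j, ?_⟩
    have hβ : ∑ j ∈ Finset.range l, (if j = l then -c else β j) • (f j + f (j + 1)) =
        ∑ j ∈ Finset.range l, β j • (f j + f (j + 1)) :=
      Finset.sum_congr rfl fun j hj => by rw [if_neg (Finset.mem_range.mp hj).ne]
    rw [Finset.sum_range_succ, Finset.sum_range_succ, hβ, ← sub_sub, h]
    simp only [if_true]
    module

/-- Folding a sum over `0, …, 2l` about its middle term. -/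
theorem Finset.sum_range_two_mul_add_one_fold {M : Type*} [AddCommMonoid M] (g : ℕ → M) (l : ℕ) :
    ∑ j ∈ Finset.range (2 * l + 1), g j =
      ∑ j ∈ Finset.range l, (g j + g (2 * l - j)) + g l := by
  have hreflect : ∑ j ∈ Finset.range l, g (l + (j + 1)) =
      ∑ j ∈ Finset.range l, g (2 * l - j) := by
    rw [← Finset.sum_range_reflect]
    refine Finset.sum_congr rfl fun j hj => ?_
    have := Finset.mem_range.mp hj
    congr 1
    omega
  rw [show 2 * l + 1 = l + (l + 1) by omega, Finset.sum_range_add, Finset.sum_range_succ',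
    hreflect, Finset.sum_add_distrib, add_zero, add_assoc]

/-- there exist `α, β₁, …, β_l ∈ ℝ` with
`α x_{p+1} x_{p+2l-1} - Σ_{j=1}^{l} β_j (x_{p+2l-j+1} x_{p+j-1} + x_{p+2l-j} x_{p+j}) = τ_p^{2l}`
(1-based variable indices; the `Fin l`-index `j` stands for `j+1 ∈ {1,…,l}`). -/
theorem tau_in_image_of_outer_operator (n p l : ℕ) (hp : 1 ≤ p) (hl : 1 ≤ l)
    (h : p + 2 * l ≤ n) :
    ∃ (α : ℝ) (β : Fin l → ℝ),
      C α * (X (⟨p, by omega⟩ : Fin n) * X (⟨p + 2 * l - 2, by omega⟩ : Fin n)) -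
        ∑ j : Fin l, C (β j) *
          (X (⟨p + 2 * l - ((j : ℕ) + 1), by have hj := j.isLt; omega⟩ : Fin n) *
             X (⟨p + ((j : ℕ) + 1) - 2, by have hj := j.isLt; omega⟩ : Fin n) +
           X (⟨p + 2 * l - ((j : ℕ) + 1) - 1, by have hj := j.isLt; omega⟩ : Fin n) *
             X (⟨p + (j : ℕ), by have hj := j.isLt; omega⟩ : Fin n)) =
      tau n p (2 * l) hp h := by
  let y : ℕ → MvPolynomial (Fin n) ℝ := fun i => if hi : i < n then X ⟨i, hi⟩ else 0
  have hy : ∀ (i : ℕ) (hi : i < n), (X (⟨i, hi⟩ : Fin n) : MvPolynomial (Fin n) ℝ) = y i :=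
    fun i hi => by simp only [y, dif_pos hi]
  let f : ℕ → MvPolynomial (Fin n) ℝ := fun j => y (p + (2 * l - j) - 1) * y (p + j - 1)
  have hf : ∀ j ≤ 2 * l, f (2 * l - j) = f j := fun j hj => by
    simp only [f, Nat.sub_sub_self hj]
    exact mul_comm _ _
  let c : ℕ → ℝ := fun j =>
    (-1 : ℝ) ^ (2 * l - j) * (Nat.choose (n - p - (2 * l - j)) j : ℝ) *
      (Nat.choose (n - p - j) (2 * l - j) : ℝ)
  have htau : tau n p (2 * l) hp h =
      ∑ j ∈ Finset.range l, (c j + c (2 * l - j)) • f j + c l • f l := by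
    calc tau n p (2 * l) hp h = ∑ j ∈ Finset.range (2 * l + 1), c j • f j := by
          simp only [tau, hy, ← smul_eq_C_mul]
          exact Fin.sum_univ_eq_sum_range (fun j => c j • f j) (2 * l + 1)
      _ = _ := by
          rw [Finset.sum_range_two_mul_add_one_fold]
          congr 1
          refine Finset.sum_congr rfl fun j hj => ?_
          have := Finset.mem_range.mp hj
          rw [hf j (by omega), add_smul]
  obtain ⟨α, β, hαβ⟩ :=
    exists_smul_sub_sum_smul_add_succ f (fun j => c j + c (2 * l - j)) l hl (c l)
  refine ⟨α, fun j => β j, ?_⟩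
  rw [htau, ← hαβ, ← Fin.sum_univ_eq_sum_range (fun j => β j • (f j + f (j + 1)))]
  simp only [hy, ← smul_eq_C_mul, f]
  congr 1
  · rw [mul_comm]
    congr 3
    omega
  · refine Finset.sum_congr rfl fun j _ => ?_
    have := j.isLt
    congr 3 <;> congr 1 <;> omega
end

section
/- Let n ≥ 2, let a₂ ≠ 0 be a real number, and let c₀, …, c_n ∈ ℝ. Work in ℝ[μ][x_1, x_2] with derivations over ℝ[μ] (so μ is a parameter annihilated by ∂/∂x_1 and ∂/∂x_2), and set ℒ₁ = (x_2 + μ x_1 + a₂ x_1²) ∂/∂x_1. Then there exist real numbers α₀,…,α_{n−1} and β₀,…,β_{n−1} such that, with c = (Σ_{i=0}^{n−1} β_i μ^i x_1^{n−i}) ∂/∂x_1 and o = Σ_{i=0}^{n−1} α_i μ^i x_1^{n−i−1}, the following identity holds: (Σ_{i=0}^{n} c_i μ^i x_1^{n−i+1}) ∂/∂x_1 + [c, ℒ₁] + o·(x_2 + μ x_1 + a₂ x_1²) ∂/∂x_1 = (Σ_{k=0}^{n} (−1/(2a₂))^k c_{n−k}) μ^n x_1 ∂/∂x_1. -/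
open MvPolynomial

/-- A vector field `f ∂/∂x₁` in `ℝ[μ][x₁,x₂]`, modelled as a derivation of
`MvPolynomial (Fin 3) ℝ` with variables `x₁ = X 0`, `x₂ = X 1`, `μ = X 2`
(the derivation annihilates the parameter `μ`). -/
noncomputable def vf2 (f : MvPolynomial (Fin 3) ℝ) :
    Derivation ℝ (MvPolynomial (Fin 3) ℝ) (MvPolynomial (Fin 3) ℝ) :=
  MvPolynomial.mkDerivation ℝ (fun v : Fin 3 => if v = 0 then f else 0)

theorem vf2_apply (f g : MvPolynomial (Fin 3) ℝ) : vf2 f g = f * pderiv 0 g := by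
  have h : vf2 f = f • pderiv (0 : Fin 3) := by
    refine MvPolynomial.derivation_ext fun v => ?_
    by_cases hv : v = 0
    · subst hv
      simp [vf2, mkDerivation_X]
    · simp [vf2, mkDerivation_X, hv]
  rw [h, Derivation.smul_apply, smul_eq_mul]

theorem vf2_add (f g : MvPolynomial (Fin 3) ℝ) : vf2 (f + g) = vf2 f + vf2 g := by
  refine Derivation.ext fun p => ?_
  simp only [Derivation.add_apply, vf2_apply, add_mul]

theorem lie_vf2 (f g : MvPolynomial (Fin 3) ℝ) :
    ⁅vf2 f, vf2 g⁆ = vf2 (f * pderiv 0 g - g * pderiv 0 f) := by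
  refine MvPolynomial.derivation_ext fun v => ?_
  by_cases hv : v = 0
  · subst hv
    simp [Derivation.commutator_apply, vf2_apply]
  · simp [Derivation.commutator_apply, vf2_apply, pderiv_X, hv]

/-- The partial sums `∑_{k ≤ m} r^k c_{m-k}` satisfy a first-order recursion. -/
theorem sum_range_pow_mul_sub_succ (r : ℝ) (c : ℕ → ℝ) (m : ℕ) :
    ∑ k ∈ Finset.range (m + 2), r ^ k * c (m + 1 - k) =
      c (m + 1) + r * ∑ k ∈ Finset.range (m + 1), r ^ k * c (m - k) := by
  rw [Finset.sum_range_succ', Finset.mul_sum, add_comm]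
  congr 1
  · simp
  · refine Finset.sum_congr rfl fun k _ => ?_
    rw [Nat.add_sub_add_right]
    ring

theorem grade_sum_telescope {a r : ℝ} (hr : 2 * a * r = -1) {c s : ℕ → ℝ} (h0 : s 0 = c 0)
    (hs : ∀ m, s (m + 1) = c (m + 1) + r * s m) {n m : ℕ} (hm : m ≤ n) :
    (∑ i ∈ Finset.range (m + 1),
        C (c i) * X (2 : Fin 3) ^ i * X (0 : Fin 3) ^ (n - i + 1) : MvPolynomial (Fin 3) ℝ) +
      (∑ i ∈ Finset.range m, C (r * s i) * X (2 : Fin 3) ^ i * X (0 : Fin 3) ^ (n - i)) *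
        (X 2 + 2 * C a * X 0) =
      C (s m) * X 2 ^ m * X 0 ^ (n - m + 1) := by
  induction m with
  | zero => simp [h0]
  | succ m ih =>
    have ih := ih (by omega)
    have hr' : (2 * C a * C r : MvPolynomial (Fin 3) ℝ) = -1 := by
      rw [← map_ofNat C 2, ← C_mul, ← C_mul, hr, C_neg, C_1]
    have he : n - m = n - (m + 1) + 1 := by omega
    rw [Finset.sum_range_succ _ (m + 1),
      Finset.sum_range_succ (fun i => C (r * s i) * X 2 ^ i * X 0 ^ (n - i)) m, hs, ← he]
    simp only [C_add, C_mul] at ih ⊢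
    linear_combination ih + C (s m) * X 2 ^ m * X 0 ^ (n - m + 1) * hr'

/-- grade-`n` step of the 2D outer normal form: with
`ℒ₁ = (x₂ + μx₁ + a₂x₁²) ∂/∂x₁` and coefficients `c₀,…,c_n`, there are reals
`α₀,…,α_{n−1}`, `β₀,…,β_{n−1}` such that, with
`c = (Σ βᵢ μ^i x₁^{n−i}) ∂/∂x₁` and `o = Σ αᵢ μ^i x₁^{n−i−1}`,
`(Σ cᵢ μ^i x₁^{n−i+1}) ∂/∂x₁ + [c, ℒ₁] + o·(x₂ + μx₁ + a₂x₁²) ∂/∂x₁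
  = (Σ_{k=0}^n (−1/(2a₂))^k c_{n−k}) μ^n x₁ ∂/∂x₁`. -/
theorem outer_normal_form_2d_grade_n (n : ℕ) (hn : 2 ≤ n) (a₂ : ℝ) (ha : a₂ ≠ 0)
    (cf : Fin (n + 1) → ℝ) :
    ∃ (α β : Fin n → ℝ),
      vf2 (∑ i : Fin (n + 1),
          C (cf i) * X (2 : Fin 3) ^ (i : ℕ) * X (0 : Fin 3) ^ (n - (i : ℕ) + 1)) +
        ⁅vf2 (∑ i : Fin n,
            C (β i) * X (2 : Fin 3) ^ (i : ℕ) * X (0 : Fin 3) ^ (n - (i : ℕ))),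
          vf2 (X (1 : Fin 3) + X (2 : Fin 3) * X (0 : Fin 3) + C a₂ * X (0 : Fin 3) ^ 2)⁆ +
        vf2 ((∑ i : Fin n,
            C (α i) * X (2 : Fin 3) ^ (i : ℕ) * X (0 : Fin 3) ^ (n - (i : ℕ) - 1)) *
          (X (1 : Fin 3) + X (2 : Fin 3) * X (0 : Fin 3) + C a₂ * X (0 : Fin 3) ^ 2)) =
      vf2 (C (∑ k : Fin (n + 1), (-1 / (2 * a₂)) ^ (k : ℕ) * cf ⟨n - (k : ℕ), by omega⟩) *
        X (2 : Fin 3) ^ n * X (0 : Fin 3)) := by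
  have hr : 2 * a₂ * (-1 / (2 * a₂)) = -1 := by field_simp
  set r : ℝ := -1 / (2 * a₂)
  let c : ℕ → ℝ := fun i => if h : i < n + 1 then cf ⟨i, h⟩ else 0
  let s : ℕ → ℝ := fun m => ∑ k ∈ Finset.range (m + 1), r ^ k * c (m - k)
  have hc : ∀ i : Fin (n + 1), cf i = c i := fun i => by
    simp only [c, i.isLt, dif_pos]
  have htel := grade_sum_telescope hr (c := c) (s := s) (by simp [s])
    (sum_range_pow_mul_sub_succ r c) (le_refl n)
  refine ⟨fun i => (n - (i : ℕ) : ℕ) * (r * s i), fun i => r * s i, ?_⟩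
  have hsum : ∑ k : Fin (n + 1), r ^ (k : ℕ) * cf ⟨n - (k : ℕ), by omega⟩ = s n := by
    simp only [hc, s]
    exact Fin.sum_univ_eq_sum_range (fun k => r ^ k * c (n - k)) (n + 1)
  have hd : pderiv 0 (∑ i : Fin n,
        C (r * s i) * X (2 : Fin 3) ^ (i : ℕ) * X (0 : Fin 3) ^ (n - (i : ℕ))) =
      ∑ i : Fin n, C ((n - (i : ℕ) : ℕ) * (r * s i)) * X (2 : Fin 3) ^ (i : ℕ) *
        X (0 : Fin 3) ^ (n - (i : ℕ) - 1) := by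
    rw [map_sum]
    refine Finset.sum_congr rfl fun i _ => ?_
    simp only [Derivation.leibniz, Derivation.leibniz_pow, pderiv_C, pderiv_X_self,
      pderiv_X_of_ne (show (2 : Fin 3) ≠ 0 by decide), smul_eq_mul, nsmul_eq_mul, C_mul,
      map_natCast]
    ring
  have hL : pderiv 0 (X (1 : Fin 3) + X (2 : Fin 3) * X (0 : Fin 3) +
      C a₂ * X (0 : Fin 3) ^ 2 : MvPolynomial (Fin 3) ℝ) = X 2 + 2 * C a₂ * X 0 := by
    simp only [map_add, Derivation.leibniz, Derivation.leibniz_pow, pderiv_C, pderiv_X_self,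
      pderiv_X_of_ne (show (2 : Fin 3) ≠ 0 by decide),
      pderiv_X_of_ne (show (1 : Fin 3) ≠ 0 by decide), smul_eq_mul, nsmul_eq_mul]
    push_cast
    ring
  rw [lie_vf2, ← vf2_add, ← vf2_add, hsum, hd, hL]
  congr 1
  simp only [hc]
  rw [Fin.sum_univ_eq_sum_range
      (fun i => C (c i) * X (2 : Fin 3) ^ i * X (0 : Fin 3) ^ (n - i + 1)) (n + 1),
    Fin.sum_univ_eq_sum_range
      (fun i => C (r * s i) * X (2 : Fin 3) ^ i * X (0 : Fin 3) ^ (n - i)) n]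
  rw [Nat.sub_self, zero_add, pow_one] at htel
  linear_combination htel
end

section
/- In ℝ[x_1,x_2,x_3] let Δ = 2x_1x_3 − x_2². For all integers m, q, s, i, j, k ≥ 0 with m + i ≥ 1 and s + k ≥ 1, the following bracket identity of derivations holds: [x_1^m x_2^q Δ^s ∂/∂x_1, x_1^i x_2^j Δ^k ∂/∂x_1] = x_1^{m+i−1} x_2^{q+j} ( (i + k − m − s)·Δ^{s+k} + (k − s)·x_2²·Δ^{s+k−1} ) ∂/∂x_1. -/
open MvPolynomial

/-- `Δ = 2x₁x₃ − x₂²` in `ℝ[x₁,x₂,x₃]` (variables `x₁ = X 0`, `x₂ = X 1`, `x₃ = X 2`). -/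
noncomputable def Δp : MvPolynomial (Fin 3) ℝ :=
  2 * X (0 : Fin 3) * X (2 : Fin 3) - X (1 : Fin 3) ^ 2

/-- A vector field `f ∂/∂x₁` as a derivation of `ℝ[x₁,x₂,x₃]`. -/
noncomputable def vf3 (f : MvPolynomial (Fin 3) ℝ) :
    Derivation ℝ (MvPolynomial (Fin 3) ℝ) (MvPolynomial (Fin 3) ℝ) :=
  MvPolynomial.mkDerivation ℝ (fun v : Fin 3 => if v = 0 then f else 0)

theorem vf3_X_zero (f : MvPolynomial (Fin 3) ℝ) : vf3 f (X 0) = f := by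
  simp [vf3, mkDerivation_X]

theorem vf3_X_of_ne_zero (f : MvPolynomial (Fin 3) ℝ) {v : Fin 3} (hv : v ≠ 0) :
    vf3 f (X v) = 0 := by
  simp [vf3, mkDerivation_X, hv]

theorem vf3_Δp (f : MvPolynomial (Fin 3) ℝ) : vf3 f Δp = 2 * X 2 * f := by
  have h : vf3 f 2 = 0 := (vf3 f).map_natCast 2
  simp only [Δp, map_sub, Derivation.leibniz, Derivation.leibniz_pow, smul_eq_mul, vf3_X_zero,
    vf3_X_of_ne_zero f (show (1 : Fin 3) ≠ 0 by decide),
    vf3_X_of_ne_zero f (show (2 : Fin 3) ≠ 0 by decide), h]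
  simp only [mul_zero, smul_zero]
  ring

/-- The bracket of `f ∂/∂x₁` and `g ∂/∂x₁` is `(f ∂g/∂x₁ − g ∂f/∂x₁) ∂/∂x₁`. -/
theorem lie_vf3 (f g : MvPolynomial (Fin 3) ℝ) :
    ⁅vf3 f, vf3 g⁆ = vf3 (vf3 f g - vf3 g f) := by
  refine MvPolynomial.derivation_ext fun v => ?_
  rw [Derivation.commutator_apply]
  by_cases hv : v = 0
  · subst hv
    simp only [vf3_X_zero]
  · simp only [vf3_X_of_ne_zero _ hv, map_zero, sub_zero]

/-- `f ∂/∂x₁` applied to `x₁^i x₂^j Δ^k`. -/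
theorem vf3_monomial (f : MvPolynomial (Fin 3) ℝ) (i j k : ℕ) :
    vf3 f (X 0 ^ i * X 1 ^ j * Δp ^ k) =
      f * X 1 ^ j * ((i : MvPolynomial (Fin 3) ℝ) * X 0 ^ (i - 1) * Δp ^ k +
        X 0 ^ i * ((k : MvPolynomial (Fin 3) ℝ) * Δp ^ (k - 1)) * (2 * X 2)) := by
  simp only [Derivation.leibniz, Derivation.leibniz_pow, smul_eq_mul, nsmul_eq_mul, vf3_X_zero,
    vf3_X_of_ne_zero f (show (1 : Fin 3) ≠ 0 by decide), vf3_Δp]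
  ring

theorem pow_mul_natCast_mul_pow_sub_one {R : Type*} [CommSemiring R] (a : R) (m n : ℕ) :
    a ^ m * (n * a ^ (n - 1)) = n * a ^ (m + n - 1) := by
  cases n with
  | zero => simp
  | succ n =>
    rw [Nat.add_sub_cancel, ← Nat.add_assoc, Nat.add_sub_cancel]
    ring

/-- the structure constants
`[x₁^m x₂^q Δ^s ∂/∂x₁, x₁^i x₂^j Δ^k ∂/∂x₁]
  = x₁^{m+i−1} x₂^{q+j} ((i+k−m−s)·Δ^{s+k} + (k−s)·x₂²·Δ^{s+k−1}) ∂/∂x₁`,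
for `m + i ≥ 1` and `s + k ≥ 1`. -/
theorem bracket_structure_constants_3d (m q s i j k : ℕ)
    (h1 : 1 ≤ m + i) (h2 : 1 ≤ s + k) :
    ⁅vf3 (X (0 : Fin 3) ^ m * X (1 : Fin 3) ^ q * Δp ^ s),
      vf3 (X (0 : Fin 3) ^ i * X (1 : Fin 3) ^ j * Δp ^ k)⁆ =
      vf3 (X (0 : Fin 3) ^ (m + i - 1) * X (1 : Fin 3) ^ (q + j) *
        (C (((i : ℝ) + (k : ℝ)) - ((m : ℝ) + (s : ℝ))) * Δp ^ (s + k) +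
         C ((k : ℝ) - (s : ℝ)) * (X (1 : Fin 3) ^ 2 * Δp ^ (s + k - 1)))) := by
  rw [lie_vf3, vf3_monomial, vf3_monomial]
  congr 1
  have hx₁ := pow_mul_natCast_mul_pow_sub_one (X 0 : MvPolynomial (Fin 3) ℝ) m i
  have hx₂ := pow_mul_natCast_mul_pow_sub_one (X 0 : MvPolynomial (Fin 3) ℝ) i m
  have hΔ₁ := pow_mul_natCast_mul_pow_sub_one Δp s k
  have hΔ₂ := pow_mul_natCast_mul_pow_sub_one Δp k s
  rw [Nat.add_comm i m] at hx₂
  rw [Nat.add_comm k s] at hΔ₂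
  have hx : (X 0 : MvPolynomial (Fin 3) ℝ) ^ m * X 0 ^ i = X 0 ^ (m + i - 1) * X 0 := by
    rw [← pow_add, ← pow_succ, Nat.sub_add_cancel h1]
  have hΔ : Δp ^ s * Δp ^ k = Δp ^ (s + k - 1) * Δp := by
    rw [← pow_add, ← pow_succ, Nat.sub_add_cancel h2]
  have hΔp : 2 * X 0 * X 2 = Δp + X 1 ^ 2 := by
    rw [Δp, sub_add_cancel]
  simp only [C_sub, C_add, map_natCast]
  rw [pow_add Δp, pow_add (X 1), hΔ]
  set E : MvPolynomial (Fin 3) ℝ := X 0 ^ (m + i - 1)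
  set F := Δp ^ (s + k - 1)
  set y : MvPolynomial (Fin 3) ℝ := X 1 ^ q * X 1 ^ j
  linear_combination
    y * (Δp ^ s * Δp ^ k) * (hx₁ - hx₂) + y * (i - m) * E * hΔ
      + y * (X 0 ^ m * X 0 ^ i) * (2 * X 2) * (hΔ₁ - hΔ₂)
      + y * (k - s) * F * (2 * X 2) * hx + y * (k - s) * F * E * hΔp
end

section
/- In ℝ[x_1,x_2,x_3] let Δ = 2x_1x_3 − x_2² and let N = x_2 ∂/∂x_1 + x_3 ∂/∂x_2. For all integers i ≥ 1, j ≥ 1, k ≥ 0, the following bracket identity of derivations holds: [x_1^i x_2^j Δ^k ∂/∂x_1, N] = −(1/2)·x_1^{i−1}·Δ^k·( j·x_2^{j−1}·Δ + (2i + j)·x_2^{j+1} ) ∂/∂x_1. -/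
open MvPolynomial

/-- `N = x₂ ∂/∂x₁ + x₃ ∂/∂x₂` as a derivation of `ℝ[x₁,x₂,x₃]`. -/
noncomputable def N3 :
    Derivation ℝ (MvPolynomial (Fin 3) ℝ) (MvPolynomial (Fin 3) ℝ) :=
  MvPolynomial.mkDerivation ℝ (fun v : Fin 3 =>
    if v = 0 then X (1 : Fin 3) else if v = 1 then X (2 : Fin 3) else 0)

theorem N3_Δp : N3 Δp = 0 := by
  have h2 : N3 2 = 0 := mod_cast N3.map_natCast 2
  simp only [Δp, map_sub, Derivation.leibniz, Derivation.leibniz_pow, h2, smul_eq_mul,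
    nsmul_eq_mul]
  simp [N3, mkDerivation_X]
  ring

/-- for `i, j ≥ 1`, `k ≥ 0`,
`[x₁^i x₂^j Δ^k ∂/∂x₁, N] = −(1/2)·x₁^{i−1}·Δ^k·(j·x₂^{j−1}·Δ + (2i+j)·x₂^{j+1}) ∂/∂x₁`. -/
theorem bracket_with_N_3d (i j k : ℕ) (hi : 1 ≤ i) (hj : 1 ≤ j) :
    ⁅vf3 (X (0 : Fin 3) ^ i * X (1 : Fin 3) ^ j * Δp ^ k), N3⁆ =
      vf3 (C (-(1 / 2) : ℝ) * (X (0 : Fin 3) ^ (i - 1) * Δp ^ k *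
        (C (j : ℝ) * (X (1 : Fin 3) ^ (j - 1) * Δp) +
         C ((2 * i + j : ℕ) : ℝ) * X (1 : Fin 3) ^ (j + 1)))) := by
  obtain ⟨i, rfl⟩ := Nat.exists_eq_add_of_le' hi
  obtain ⟨j, rfl⟩ := Nat.exists_eq_add_of_le' hj
  have hN0 : N3 (X 0) = X 1 := by simp [N3, mkDerivation_X]
  have hN1 : N3 (X 1) = X 2 := by simp [N3, mkDerivation_X]
  have hN2 : N3 (X 2) = 0 := by simp [N3, mkDerivation_X]
  have hv0 (f) : vf3 f (X 0) = f := by simp [vf3, mkDerivation_X]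
  have hv1 (f) : vf3 f (X 1) = 0 := by simp [vf3, mkDerivation_X]
  have hv2 (f) : vf3 f (X 2) = 0 := by simp [vf3, mkDerivation_X]
  have hC : (2 : MvPolynomial (Fin 3) ℝ) * C (-(1 / 2) : ℝ) = -1 := by
    rw [← map_ofNat C 2, ← C_mul]; norm_num
  refine derivation_ext fun v => ?_
  rw [Derivation.commutator_apply]
  fin_cases v
  · simp only [Fin.zero_eta, hN0, hv0, hv1, Derivation.leibniz, Derivation.leibniz_pow, N3_Δp,
      hN1, smul_eq_mul, nsmul_eq_mul, Nat.add_sub_cancel, map_natCast]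
    push_cast
    generalize Δp ^ k = D
    rw [Δp]
    linear_combination (-(X 0 ^ i * D * ((j + 1) * X 1 ^ j * X 0 * X 2
      + (i + 1) * X 1 ^ (j + 2)))) * hC
  · simp [hN1, hv1, hv2]
  · simp [hN2, hv2]
end

section
/- Consider the derivation M = 2x_1 ∂/∂x_2 + 2x_2 ∂/∂x_3 of ℝ[x_1,x_2,x_3]. The kernel of M, i.e., the set of polynomials f ∈ ℝ[x_1,x_2,x_3] with 2x_1 ∂f/∂x_2 + 2x_2 ∂f/∂x_3 = 0, equals the ℝ-subalgebra of ℝ[x_1,x_2,x_3] generated by x_1 and Δ = 2x_1x_3 − x_2². -/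
open MvPolynomial

/-- The raising operator `M = 2x₁ ∂/∂x₂ + 2x₂ ∂/∂x₃` as a derivation of `ℝ[x₁,x₂,x₃]`. -/
noncomputable def M3 :
    Derivation ℝ (MvPolynomial (Fin 3) ℝ) (MvPolynomial (Fin 3) ℝ) :=
  MvPolynomial.mkDerivation ℝ (fun v : Fin 3 =>
    if v = 1 then 2 * X (0 : Fin 3) else if v = 2 then 2 * X (1 : Fin 3) else 0)

/-- The subalgebra `ℝ[x₁, Δ]`. -/
noncomputable abbrev adjoinX1Delta : Subalgebra ℝ (MvPolynomial (Fin 3) ℝ) :=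
  Algebra.adjoin ℝ ({X (0 : Fin 3), Δp} : Set (MvPolynomial (Fin 3) ℝ))

lemma X0_mem_adjoinX1Delta : X (0 : Fin 3) ∈ adjoinX1Delta :=
  Algebra.subset_adjoin (by simp)

lemma Δp_mem_adjoinX1Delta : Δp ∈ adjoinX1Delta :=
  Algebra.subset_adjoin (by simp)

lemma M3_X0 : M3 (X 0) = 0 := by simp [M3, mkDerivation_X]

lemma M3_X1 : M3 (X 1) = 2 * X 0 := by simp [M3, mkDerivation_X]

lemma M3_X2 : M3 (X 2) = 2 * X 1 := by simp [M3, mkDerivation_X]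

lemma M3_Δp : M3 Δp = 0 := by
  have h : Δp = X 0 * X 2 + X 0 * X 2 - X 1 * X 1 := by rw [Δp]; ring
  simp only [h, map_sub, map_add, Derivation.leibniz, M3_X0, M3_X1, M3_X2, smul_eq_mul]
  ring

lemma M3_eq_zero_of_mem_adjoinX1Delta {f : MvPolynomial (Fin 3) ℝ} (hf : f ∈ adjoinX1Delta) :
    M3 f = 0 := by
  induction hf using Algebra.adjoin_induction with
  | mem x hx =>
    rcases hx with rfl | rfl
    exacts [M3_X0, M3_Δp]
  | algebraMap r => exact M3.map_algebraMap r
  | add x y _ _ hx hy => rw [map_add, hx, hy, add_zero]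
  | mul x y _ _ hx hy => simp [Derivation.leibniz, hx, hy]

/-- Up to a power of `x₁`, every polynomial is a polynomial in `x₂` over `ℝ[x₁, Δ]`. -/
lemma exists_X0_pow_mul_eq_aeval_X1 (f : MvPolynomial (Fin 3) ℝ) :
    ∃ (n : ℕ) (P : Polynomial adjoinX1Delta),
      X 0 ^ n * f = Polynomial.aeval (X 1 : MvPolynomial (Fin 3) ℝ) P := by
  induction f using MvPolynomial.induction_on with
  | C a => exact ⟨0, Polynomial.C (algebraMap ℝ _ a), by
      rw [Polynomial.aeval_C, pow_zero, one_mul]; rfl⟩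
  | add p q hp hq =>
    obtain ⟨n, P, hP⟩ := hp
    obtain ⟨m, Q, hQ⟩ := hq
    let x : adjoinX1Delta := ⟨X 0, X0_mem_adjoinX1Delta⟩
    have hx : algebraMap adjoinX1Delta (MvPolynomial (Fin 3) ℝ) x = X 0 := rfl
    refine ⟨n + m, Polynomial.C (x ^ m) * P + Polynomial.C (x ^ n) * Q, ?_⟩
    simp only [map_add, map_mul, Polynomial.aeval_C, map_pow, hx, ← hP, ← hQ]
    ring
  | mul_X p i hp =>
    obtain ⟨n, P, hP⟩ := hp
    fin_cases i
    · let x : adjoinX1Delta := ⟨X 0, X0_mem_adjoinX1Delta⟩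
      have hx : algebraMap adjoinX1Delta (MvPolynomial (Fin 3) ℝ) x = X 0 := rfl
      refine ⟨n, P * Polynomial.C x, ?_⟩
      simp only [map_mul, Polynomial.aeval_C, hx, ← hP, Fin.zero_eta]
      ring
    · refine ⟨n, P * Polynomial.X, ?_⟩
      simp only [map_mul, Polynomial.aeval_X, ← hP, Fin.mk_one]
      ring
    · let d : adjoinX1Delta := ⟨Δp, Δp_mem_adjoinX1Delta⟩
      have hd : algebraMap adjoinX1Delta (MvPolynomial (Fin 3) ℝ) d = Δp := rfl
      let c : adjoinX1Delta := algebraMap ℝ _ (1 / 2)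
      have hc : algebraMap adjoinX1Delta (MvPolynomial (Fin 3) ℝ) c = C (1 / 2) := rfl
      have h2 : (C (1 / 2) : MvPolynomial (Fin 3) ℝ) * 2 = 1 := by
        rw [← map_ofNat C 2, ← C_mul]; norm_num
      refine ⟨n + 1, P * (Polynomial.C c * (Polynomial.C d + Polynomial.X ^ 2)), ?_⟩
      simp only [map_mul, map_add, map_pow, Polynomial.aeval_X, Polynomial.aeval_C, hd, hc, ← hP,
        Fin.reduceFinMk, Δp]
      linear_combination (-(X 0 ^ (n + 1) * p * X 2)) * h2

lemma M3_aeval_X1 (P : Polynomial adjoinX1Delta) :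
    M3 (Polynomial.aeval (X 1 : MvPolynomial (Fin 3) ℝ) P) =
      2 * X 0 * Polynomial.aeval (X 1 : MvPolynomial (Fin 3) ℝ) P.derivative := by
  induction P using Polynomial.induction_on' with
  | add p q hp hq => simp only [map_add, hp, hq, mul_add]
  | monomial n a =>
    have ha : M3 (algebraMap adjoinX1Delta (MvPolynomial (Fin 3) ℝ) a) = 0 :=
      M3_eq_zero_of_mem_adjoinX1Delta a.2
    rw [Polynomial.derivative_monomial, Polynomial.aeval_monomial, Polynomial.aeval_monomial,
      Derivation.leibniz, ha, Derivation.leibniz_pow, M3_X1]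
    simp only [smul_eq_mul, nsmul_eq_mul, map_mul, map_natCast]
    ring

/-- A polynomial in `x₂` over `ℝ[x₁, Δ]` whose formal derivative vanishes at `x₂` takes its value
in `ℝ[x₁, Δ]`. -/
lemma aeval_X1_mem_of_aeval_derivative_eq_zero (d : ℕ) (P : Polynomial adjoinX1Delta)
    (hd : P.natDegree ≤ d)
    (hP : Polynomial.aeval (X 1 : MvPolynomial (Fin 3) ℝ) P.derivative = 0) :
    Polynomial.aeval (X 1 : MvPolynomial (Fin 3) ℝ) P ∈ adjoinX1Delta := by
  induction d generalizing P with
  | zero =>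
    rw [Polynomial.eq_C_of_natDegree_le_zero hd, Polynomial.aeval_C]
    exact (P.coeff 0).2
  | succ d ih =>
    let Q : Polynomial adjoinX1Delta := (d + 1 : ℕ) • P - Polynomial.X * P.derivative
    have hQ : Polynomial.aeval (X 1 : MvPolynomial (Fin 3) ℝ) Q =
        (d + 1 : ℕ) • Polynomial.aeval (X 1 : MvPolynomial (Fin 3) ℝ) P := by
      have h : Q + Polynomial.X * P.derivative = (d + 1 : ℕ) • P :=
        sub_add_cancel ((d + 1 : ℕ) • P) _
      rw [← map_nsmul, ← h, map_add, map_mul, hP, mul_zero, add_zero]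
    have hQd : Q.natDegree ≤ d := by
      rw [Polynomial.natDegree_le_iff_coeff_eq_zero]
      intro N hN
      obtain ⟨k, rfl⟩ : ∃ k, N = k + 1 := ⟨N - 1, by omega⟩
      simp only [Q, Polynomial.coeff_sub, Polynomial.coeff_smul, Polynomial.coeff_X_mul,
        Polynomial.coeff_derivative]
      obtain rfl | hk := eq_or_ne k d
      · simp only [nsmul_eq_mul]; push_cast; ring
      · rw [Polynomial.coeff_eq_zero_of_natDegree_lt (by omega)]; simp
    have hQ' : Polynomial.aeval (X 1 : MvPolynomial (Fin 3) ℝ) Q.derivative = 0 := by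
      have h : (2 * X 0 : MvPolynomial (Fin 3) ℝ) ≠ 0 := mul_ne_zero two_ne_zero (X_ne_zero 0)
      refine (mul_eq_zero.mp ?_).resolve_left h
      rw [← M3_aeval_X1, hQ, map_nsmul, M3_aeval_X1, hP, mul_zero, smul_zero]
    have hmem := ih Q hQd hQ'
    rw [hQ, ← Nat.cast_smul_eq_nsmul ℝ] at hmem
    have := adjoinX1Delta.smul_mem hmem ((d + 1 : ℕ) : ℝ)⁻¹
    rwa [inv_smul_smul₀ (by positivity)] at this

lemma exists_eq_aeval_Δp_add_X0_mul {g : MvPolynomial (Fin 3) ℝ} (hg : g ∈ adjoinX1Delta) :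
    ∃ c : Polynomial ℝ, ∃ a ∈ adjoinX1Delta, g = Polynomial.aeval Δp c + X 0 * a := by
  induction hg using Algebra.adjoin_induction with
  | mem x hx =>
    rcases hx with rfl | rfl
    · exact ⟨0, 1, one_mem _, by simp⟩
    · exact ⟨Polynomial.X, 0, zero_mem _, by simp⟩
  | algebraMap r => exact ⟨Polynomial.C r, 0, zero_mem _, by simp⟩
  | add x y _ _ hx hy =>
    obtain ⟨c, a, ha, rfl⟩ := hx
    obtain ⟨c', a', ha', rfl⟩ := hy
    exact ⟨c + c', a + a', add_mem ha ha', by rw [map_add]; ring⟩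
  | mul x y _ hy_mem hx hy =>
    obtain ⟨c, a, ha, rfl⟩ := hx
    obtain ⟨c', a', ha', h⟩ := hy
    have hc : Polynomial.aeval Δp c ∈ adjoinX1Delta :=
      Algebra.adjoin_mono (by simp) (Polynomial.aeval_mem_adjoin_singleton ℝ Δp)
    refine ⟨c * c', Polynomial.aeval Δp c * a' + a * y,
      add_mem (mul_mem hc ha') (mul_mem ha hy_mem), ?_⟩
    rw [map_mul]
    linear_combination Polynomial.aeval Δp c * h

lemma mem_adjoinX1Delta_of_X0_mul_mem {f : MvPolynomial (Fin 3) ℝ}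
    (hf : X 0 * f ∈ adjoinX1Delta) : f ∈ adjoinX1Delta := by
  obtain ⟨c, a, ha, h⟩ := exists_eq_aeval_Δp_add_X0_mul hf
  let φ : MvPolynomial (Fin 3) ℝ →ₐ[ℝ] Polynomial ℝ :=
    MvPolynomial.aeval ![0, Polynomial.X, 0]
  have hφ : φ Δp = -Polynomial.X ^ 2 := by simp [φ, Δp]
  have hφ0 : φ (X 0) = 0 := by simp [φ]
  have hcomp : c.comp (-Polynomial.X ^ 2) = 0 := by
    have := congrArg φ h
    rw [map_add, map_mul, map_mul, hφ0, zero_mul, zero_mul, add_zero,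
      ← Polynomial.aeval_algHom_apply, hφ] at this
    exact this.symm
  have hc : c = 0 := by
    have hdeg : (-Polynomial.X ^ 2 : Polynomial ℝ).natDegree = 2 := by simp
    refine (Polynomial.comp_eq_zero_iff.mp hcomp).resolve_right fun h' => ?_
    rw [h'.2, Polynomial.natDegree_C] at hdeg
    exact absurd hdeg (by norm_num)
  rw [hc, map_zero, zero_add] at h
  rwa [mul_left_cancel₀ (X_ne_zero 0) h]

lemma mem_adjoinX1Delta_of_X0_pow_mul_mem (n : ℕ) {f : MvPolynomial (Fin 3) ℝ}
    (hf : X 0 ^ n * f ∈ adjoinX1Delta) : f ∈ adjoinX1Delta := by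
  induction n with
  | zero => simpa using hf
  | succ n ih =>
    rw [pow_succ', mul_assoc] at hf
    exact ih (mem_adjoinX1Delta_of_X0_mul_mem hf)

/-- the kernel of `M = 2x₁ ∂/∂x₂ + 2x₂ ∂/∂x₃` in `ℝ[x₁,x₂,x₃]` is the
subalgebra generated by `x₁` and `Δ = 2x₁x₃ − x₂²`. -/
theorem ker_M3_eq_adjoin_x1_Delta :
    {f : MvPolynomial (Fin 3) ℝ | M3 f = 0} =
      (Algebra.adjoin ℝ ({X (0 : Fin 3), Δp} : Set (MvPolynomial (Fin 3) ℝ)) :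
        Subalgebra ℝ (MvPolynomial (Fin 3) ℝ)) := by
  ext f
  refine ⟨fun hf => ?_, fun hf => M3_eq_zero_of_mem_adjoinX1Delta hf⟩
  obtain ⟨n, P, hP⟩ := exists_X0_pow_mul_eq_aeval_X1 f
  refine mem_adjoinX1Delta_of_X0_pow_mul_mem n ?_
  rw [hP]
  refine aeval_X1_mem_of_aeval_derivative_eq_zero P.natDegree P le_rfl ?_
  have h : (2 * X 0 : MvPolynomial (Fin 3) ℝ) ≠ 0 := mul_ne_zero two_ne_zero (X_ne_zero 0)
  refine (mul_eq_zero.mp ?_).resolve_left h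
  have hf' : M3 f = 0 := hf
  rw [← M3_aeval_X1, ← hP, Derivation.leibniz, Derivation.leibniz_pow, M3_X0, hf']
  simp
end
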